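/- (Franz's Lemma) Let p ≥ 3 be an integer and let Z_p^× be the group of invertible residues mod p. Suppose (a_i)_{i ∈ Z_p^×} is a family of integers satisfying: (1) ∑_{i} a_i = 0; (2) a_i = a_{-i} for all i; (3) ∏_{i} (ξ^i - 1)^{a_i} = 1 for every p-th root of unity ξ ≠ 1 in ℂ. Then a_i = 0 for all i ∈ Z_p^×. -/

import Mathlib

/-- The closed unit disc minus `1` is mapped into the slit plane by `w ↦ 1 - w`. -/
lemma one_sub_mem_slitPlane_of_norm_le_one {w : ℂ} (hw : ‖w‖ ≤ 1) (hw1 : w ≠ 1) :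
    1 - w ∈ Complex.slitPlane := by
  have hre : w.re ≤ 1 := (Complex.re_le_norm w).trans hw
  rcases hre.lt_or_eq with h | h
  · exact Or.inl (by simpa using h)
  · refine absurd (Complex.ext h ?_) hw1
    have h2 : ‖w‖ ^ 2 ≤ 1 := pow_le_one₀ (norm_nonneg w) hw
    rw [Complex.sq_norm, Complex.normSq_apply, h] at h2
    have : w.im * w.im = 0 := le_antisymm (by linarith) (mul_self_nonneg _)
    simpa using this

/-- The function `∑_{n ≥ 1} z ^ n * exp (-n * t)` of `t`. -/
noncomputable def expGeomSum (z : ℂ) (t : ℝ) : ℂ :=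
  z * Real.exp (-t) / (1 - z * Real.exp (-t))

lemma norm_mul_exp_neg_le {z : ℂ} (hz : ‖z‖ ≤ 1) (t : ℝ) :
    ‖z * Real.exp (-t)‖ ≤ Real.exp (-t) := by
  rw [norm_mul, Complex.norm_real, Real.norm_of_nonneg (Real.exp_pos _).le]
  exact mul_le_of_le_one_left (Real.exp_pos _).le hz

lemma one_sub_mul_exp_neg_mem_slitPlane {z : ℂ} (hz : ‖z‖ ≤ 1) (hz1 : z ≠ 1) {t : ℝ}
    (ht : 0 ≤ t) : 1 - z * Real.exp (-t) ∈ Complex.slitPlane := by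
  rcases ht.eq_or_lt with rfl | ht
  · simpa using one_sub_mem_slitPlane_of_norm_le_one hz hz1
  · have h : ‖z * Real.exp (-t)‖ < 1 :=
      (norm_mul_exp_neg_le hz t).trans_lt (Real.exp_lt_one_iff.2 (by linarith))
    exact one_sub_mem_slitPlane_of_norm_le_one h.le fun h1 ↦ h.ne (by rw [h1, norm_one])

lemma continuousOn_expGeomSum {z : ℂ} (hz : ‖z‖ ≤ 1) (hz1 : z ≠ 1) :
    ContinuousOn (expGeomSum z) (Set.Ici 0) := by
  refine ContinuousOn.div (by fun_prop) (by fun_prop) fun t ht ↦ ?_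
  exact Complex.slitPlane_ne_zero (one_sub_mul_exp_neg_mem_slitPlane hz hz1 ht)

lemma tendsto_mul_exp_neg_atTop (z : ℂ) :
    Filter.Tendsto (fun t : ℝ ↦ z * Real.exp (-t)) Filter.atTop (nhds 0) := by
  simpa using (Complex.continuous_ofReal.tendsto' 0 0 Complex.ofReal_zero |>.comp
    Real.tendsto_exp_neg_atTop_nhds_zero).const_mul z

open Asymptotics in
lemma expGeomSum_isBigO_atTop {z : ℂ} (hz : ‖z‖ ≤ 1) :
    expGeomSum z =O[Filter.atTop] fun t ↦ Real.exp (-1 * t) := by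
  have h : Filter.Tendsto (fun t : ℝ ↦ (1 - z * Real.exp (-t))⁻¹) Filter.atTop (nhds 1) := by
    simpa using ((tendsto_mul_exp_neg_atTop z).const_sub 1).inv₀ (by simp)
  have h1 : (fun t : ℝ ↦ z * (Real.exp (-t) : ℂ)) =O[Filter.atTop] fun t ↦ Real.exp (-1 * t) :=
    .of_bound' (.of_forall fun t ↦ by
      simpa using norm_mul_exp_neg_le hz t)
  simpa only [mul_one, ← div_eq_mul_inv, ← expGeomSum.eq_1] using h1.mul (h.isBigO_one ℝ)

open Asymptotics in
lemma differentiableAt_mellin_expGeomSum {z : ℂ} (hz : ‖z‖ ≤ 1) (hz1 : z ≠ 1) {s : ℂ}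
    (hs : 0 < s.re) : DifferentiableAt ℂ (mellin (expGeomSum z)) s := by
  have hc := continuousOn_expGeomSum hz hz1
  refine mellin_differentiableAt_of_isBigO_rpow_exp (b := 0) one_pos
    ((hc.mono Set.Ioi_subset_Ici_self).locallyIntegrableOn measurableSet_Ioi)
    (expGeomSum_isBigO_atTop hz) ?_ hs
  have h0 := ((hc 0 Set.self_mem_Ici).mono Set.Ioi_subset_Ici_self).tendsto
  simpa using h0.isBigO_one ℝ

lemma integrableOn_expGeomSum {z : ℂ} (hz : ‖z‖ ≤ 1) (hz1 : z ≠ 1) :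
    MeasureTheory.IntegrableOn (expGeomSum z) (Set.Ioi 0) := by
  have hc := continuousOn_expGeomSum hz hz1
  refine (MeasureTheory.integrable_norm_iff
    ((hc.mono Set.Ioi_subset_Ici_self).aestronglyMeasurable measurableSet_Ioi)).1 ?_
  exact integrable_of_isBigO_exp_neg one_pos hc.norm (expGeomSum_isBigO_atTop hz).norm_left

lemma mellin_expGeomSum_one {z : ℂ} (hz : ‖z‖ ≤ 1) (hz1 : z ≠ 1) :
    mellin (expGeomSum z) 1 = -Complex.log (1 - z) := by
  have key := MeasureTheory.integral_Ioi_of_hasDerivAt_of_tendsto' (a := 0) (m := 0)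
    (f := fun t : ℝ ↦ Complex.log (1 - z * Real.exp (-t))) (f' := expGeomSum z) ?_
    (integrableOn_expGeomSum hz hz1) ?_
  · simpa [mellin] using key
  · intro t ht
    have h1 : HasDerivAt (fun t : ℝ ↦ 1 - z * (Real.exp (-t) : ℂ)) (z * Real.exp (-t)) t := by
      have := (((hasDerivAt_neg t).exp.ofReal_comp).const_mul z).const_sub 1
      simpa using this
    exact h1.clog_real (one_sub_mul_exp_neg_mem_slitPlane hz hz1 ht)
  · have := ((tendsto_mul_exp_neg_atTop z).const_sub 1).clog (by simp)
    simpa using this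

lemma hasSum_mellin_expGeomSum {z : ℂ} (hz : ‖z‖ ≤ 1) {s : ℂ} (hs : 1 < s.re) :
    HasSum (fun n : ℕ ↦ Complex.Gamma s * z ^ (n + 1) / ((n + 1 : ℝ) : ℂ) ^ s)
      (mellin (expGeomSum z) s) := by
  refine hasSum_mellin (a := fun n : ℕ ↦ z ^ (n + 1)) (p := fun n : ℕ ↦ (n + 1 : ℝ))
    (fun n ↦ Or.inr (by positivity)) (by linarith) (fun t ht ↦ ?_) ?_
  · have h : ‖z * Real.exp (-t)‖ < 1 := (norm_mul_exp_neg_le hz t).trans_lt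
      (Real.exp_lt_one_iff.2 (by simpa using ht))
    have := (hasSum_geometric_of_norm_lt_one h).mul_left (z * Real.exp (-t))
    rw [← div_eq_mul_inv] at this
    refine this.congr_fun fun n ↦ ?_
    rw [← pow_succ', mul_pow, ← Complex.ofReal_pow, ← Real.exp_nat_mul]
    push_cast
    ring_nf
  · have h := (summable_nat_add_iff 1).mpr (Real.summable_one_div_nat_rpow.mpr hs)
    refine h.of_nonneg_of_le (fun n ↦ by positivity) fun n ↦ ?_
    push_cast
    gcongr
    simpa using pow_le_one₀ (norm_nonneg z) hz

lemma expZeta_one_eq_neg_log {x : ℝ} (hx : (x : UnitAddCircle) ≠ 0)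
    (hz1 : Complex.exp (2 * Real.pi * Complex.I * x) ≠ 1) :
    HurwitzZeta.expZeta x 1 = -Complex.log (1 - Complex.exp (2 * Real.pi * Complex.I * x)) := by
  set z := Complex.exp (2 * Real.pi * Complex.I * x) with hzdef
  have hz : ‖z‖ ≤ 1 := by simp [hzdef, Complex.norm_exp]
  have heq (s : ℝ) (hs : s ∈ Set.Ioi 1) :
      Complex.Gamma s * HurwitzZeta.expZeta x s = mellin (expGeomSum z) s := by
    have hs' : 1 < (s : ℂ).re := by simpa using hs
    have hs0 : (s : ℂ) ≠ 0 := by intro h; simp [h] at hs'; linarith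
    have h := (HurwitzZeta.hasSum_expZeta_of_one_lt_re x hs').mul_left (Complex.Gamma s)
    rw [← hasSum_nat_add_iff' 1] at h
    simp only [Finset.range_one, Finset.sum_singleton, Nat.cast_zero,
      Complex.zero_cpow hs0, div_zero, mul_zero, sub_zero] at h
    refine h.unique ((hasSum_mellin_expGeomSum hz hs').congr_fun fun n ↦ ?_)
    rw [hzdef, ← Complex.exp_nat_mul]
    push_cast
    ring_nf
  have hl : Filter.Tendsto (fun s : ℝ ↦ Complex.Gamma s * HurwitzZeta.expZeta x s)
      (nhdsWithin 1 (Set.Ioi 1)) (nhds (HurwitzZeta.expZeta x 1)) := by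
    have h1 : ContinuousAt (fun s : ℂ ↦ Complex.Gamma s * HurwitzZeta.expZeta x s) (1 : ℝ) :=
      ((Complex.differentiableAt_Gamma_one).continuousAt.mul
        (HurwitzZeta.differentiable_expZeta_of_ne_zero hx).continuous.continuousAt)
    simpa [Function.comp_def] using
      (h1.comp Complex.continuous_ofReal.continuousAt).tendsto.mono_left nhdsWithin_le_nhds
  have hr : Filter.Tendsto (fun s : ℝ ↦ mellin (expGeomSum z) s)
      (nhdsWithin 1 (Set.Ioi 1)) (nhds (mellin (expGeomSum z) 1)) := by
    have h1 : ContinuousAt (mellin (expGeomSum z)) (1 : ℝ) :=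
      (differentiableAt_mellin_expGeomSum hz hz1 (by simp)).continuousAt
    simpa [Function.comp_def] using
      (h1.comp Complex.continuous_ofReal.continuousAt).tendsto.mono_left nhdsWithin_le_nhds
  rw [← mellin_expGeomSum_one hz hz1]
  exact tendsto_nhds_unique hl
    (hr.congr' (eventually_nhdsWithin_of_forall fun s hs ↦ (heq s hs).symm))

open ZMod in
lemma stdAddChar_ne_one {N : ℕ} [NeZero N] {j : ZMod N} (hj : j ≠ 0) : stdAddChar j ≠ 1 := by
  rw [← AddChar.map_zero_eq_one (stdAddChar (N := N))]
  exact injective_stdAddChar.ne hj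

open ZMod in
lemma expZeta_toAddCircle_one {N : ℕ} [NeZero N] {j : ZMod N} (hj : j ≠ 0) :
    HurwitzZeta.expZeta (toAddCircle j) 1 = -Complex.log (1 - stdAddChar j) := by
  have hexp : stdAddChar j = Complex.exp (2 * Real.pi * Complex.I * (j.val / N : ℝ)) := by
    rw [stdAddChar_apply, toCircle_apply]
    push_cast
    ring_nf
  have hne := stdAddChar_ne_one hj
  rw [hexp] at hne ⊢
  rw [toAddCircle_apply]
  refine expZeta_one_eq_neg_log ?_ hne
  rwa [← toAddCircle_apply, Ne, toAddCircle_eq_zero]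

open ZMod in
lemma expZeta_toAddCircle_one_add_neg {N : ℕ} [NeZero N] {j : ZMod N} (hj : j ≠ 0) :
    HurwitzZeta.expZeta (toAddCircle j) 1 + HurwitzZeta.expZeta (toAddCircle (-j)) 1 =
      -2 * Real.log ‖stdAddChar j - 1‖ := by
  have hne := stdAddChar_ne_one hj
  have hnorm : ‖stdAddChar j‖ = 1 := by
    rw [stdAddChar_apply, Circle.norm_coe]
  have hconj : 1 - stdAddChar (-j) = (starRingEnd ℂ) (1 - stdAddChar j) := by
    rw [AddChar.map_neg_eq_conj, map_sub, map_one]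
  rw [expZeta_toAddCircle_one hj, expZeta_toAddCircle_one (neg_ne_zero.2 hj), hconj,
    Complex.log_conj _ (Complex.mem_slitPlane_iff_arg.1
      (one_sub_mem_slitPlane_of_norm_le_one hnorm.le hne)).1, ← neg_add, Complex.add_conj,
    Complex.log_re, norm_sub_rev]
  push_cast
  ring

open ZMod in
/-- The value at `1` of the `L`-function of the discrete Fourier transform of an even function. -/
lemma LFunction_dft_one_of_even {N : ℕ} [NeZero N] {Φ : ZMod N → ℂ} (hΦ : Φ.Even)
    (h0 : Φ 0 = 0) :
    LFunction (dft Φ) 1 = -∑ j, Φ j * Real.log ‖stdAddChar j - 1‖ := by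
  have h := LFunction_dft Φ (s := 1) (Or.inl h0)
  have h' : LFunction (dft Φ) 1 = ∑ j, Φ j * HurwitzZeta.expZeta (toAddCircle j) 1 := by
    rw [h]
    exact Fintype.sum_equiv (Equiv.neg _) _ _ fun j ↦ by simp [hΦ j]
  have hsum : 2 * LFunction (dft Φ) 1 = 2 * -∑ j, Φ j * Real.log ‖stdAddChar j - 1‖ := by
    rw [two_mul]
    nth_rewrite 1 [h']
    rw [h, ← Finset.sum_add_distrib, ← Finset.sum_neg_distrib, Finset.mul_sum]
    refine Finset.sum_congr rfl fun j _ ↦ ?_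
    rcases eq_or_ne j 0 with rfl | hj
    · simp [h0]
    · rw [← mul_add, expZeta_toAddCircle_one_add_neg hj]
      ring
  exact mul_left_cancel₀ two_ne_zero hsum

open ZMod in
/-- A weight on the units of `ZMod N` that is orthogonal to all dilates of
`j ↦ log ‖ζ ^ j - 1‖` is orthogonal to all nontrivial even Dirichlet characters. -/
lemma sum_mul_even_char_eq_zero {N : ℕ} [NeZero N] {c : (ZMod N)ˣ → ℂ}
    (hc : ∀ j : ZMod N, ∑ i, c i * Real.log ‖stdAddChar (i.val * j) - 1‖ = 0)
    {χ : DirichletCharacter ℂ N} (hχ : χ ≠ 1) (heven : χ.Even) :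
    ∑ i, c i * χ i = 0 := by
  set Φ : ZMod N → ℂ := dft.symm χ with hΦdef
  have hdft : dft Φ = χ := LinearEquiv.apply_symm_apply _ _
  have hΦ : Φ.Even := dft_even_iff.1 (by rw [hdft]; exact heven.to_fun)
  have hΦ0 : Φ 0 = 0 := by
    rw [hΦdef, invDFT_apply', neg_zero, dft_apply_zero, MulChar.sum_eq_zero_of_ne_one hχ,
      smul_zero]
  have hequiv (u : (ZMod N)ˣ) (j : ZMod N) : Φ (u⁻¹.val * j) = χ u * Φ j := by
    rw [hΦdef, invDFT_apply', invDFT_apply', neg_mul_eq_mul_neg, ← dft_comp_unitMul]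
    simp only [map_mul]
    rw [dft_const_mul]
    simp only [smul_eq_mul]
    ring
  have hL := DirichletCharacter.LFunction_apply_one_ne_zero hχ
  rw [DirichletCharacter.LFunction, ← hdft, LFunction_dft_one_of_even hΦ hΦ0, neg_ne_zero] at hL
  refine (mul_eq_zero.1 ?_).resolve_right hL
  calc (∑ i, c i * χ i) * ∑ j, Φ j * Real.log ‖stdAddChar j - 1‖
      = ∑ i, c i * ∑ j, Φ (i⁻¹.val * j) * Real.log ‖stdAddChar j - 1‖ := by
        rw [Finset.sum_mul]
        simp only [hequiv, Finset.mul_sum, mul_assoc]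
    _ = ∑ i, c i * ∑ j, Φ j * Real.log ‖stdAddChar (i.val * j) - 1‖ := by
        refine Finset.sum_congr rfl fun i _ ↦ congrArg _ ?_
        exact Fintype.sum_equiv i⁻¹.mulLeft _ _ fun j ↦ by simp
    _ = ∑ j, Φ j * ∑ i, c i * Real.log ‖stdAddChar (i.val * j) - 1‖ := by
        simp only [Finset.mul_sum]
        rw [Finset.sum_comm]
        simp only [mul_left_comm]
    _ = 0 := by simp [hc]

/-- A function on the units of `ZMod N` orthogonal to all Dirichlet characters vanishes. -/
lemma eq_zero_of_forall_sum_mul_char_eq_zero {N : ℕ} [NeZero N] {c : (ZMod N)ˣ → ℂ}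
    (hc : ∀ χ : DirichletCharacter ℂ N, ∑ i, c i * χ i = 0) (u : (ZMod N)ˣ) : c u = 0 := by
  have h : ∑ χ : DirichletCharacter ℂ N, χ (u : ZMod N)⁻¹ * ∑ i, c i * χ i =
      c u * N.totient := by
    simp only [Finset.mul_sum]
    rw [Finset.sum_comm]
    simp only [mul_left_comm _ (c _), ← Finset.mul_sum,
      DirichletCharacter.sum_char_inv_mul_char_eq ℂ u.isUnit, Units.val_inj]
    simp
  simp only [hc, mul_zero, Finset.sum_const_zero] at h
  refine (mul_eq_zero.1 h.symm).resolve_right ?_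
  exact_mod_cast (Nat.totient_pos.2 (NeZero.pos N)).ne'

lemma sum_mul_odd_char_eq_zero {N : ℕ} {c : (ZMod N)ˣ → ℂ} [Fintype (ZMod N)ˣ]
    (hc : ∀ i, c i = c (-i)) {χ : DirichletCharacter ℂ N} (hodd : χ.Odd) :
    ∑ i, c i * χ i = 0 := by
  have h : ∑ i, c i * χ i = -∑ i, c i * χ i := by
    rw [← Finset.sum_neg_distrib]
    exact Fintype.sum_equiv (Equiv.neg _) _ _ fun i ↦ by simp [← hc, hodd.eval_neg]
  exact self_eq_neg.1 h

theorem franz_lemma (p : ℕ) (hp : 3 ≤ p) [NeZero p] (a : (ZMod p)ˣ → ℤ)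
    (h1 : ∑ i : (ZMod p)ˣ, a i = 0)
    (h2 : ∀ i : (ZMod p)ˣ, a i = a (-i))
    (h3 : ∀ ξ : ℂ, ξ ^ p = 1 → ξ ≠ 1 →
      ∏ i : (ZMod p)ˣ, (ξ ^ ((i : ZMod p).val) - 1) ^ (a i) = 1) :
    ∀ i, a i = 0 := by
  have hlog (j : ZMod p) :
      ∑ i : (ZMod p)ˣ, (a i : ℂ) * Real.log ‖ZMod.stdAddChar (i.val * j) - 1‖ = 0 := by
    rcases eq_or_ne j 0 with rfl | hj
    · simp
    have h := h3 (ZMod.stdAddChar j) (by simp [← AddChar.map_nsmul_eq_pow]) (stdAddChar_ne_one hj)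
    simp only [← AddChar.map_nsmul_eq_pow, nsmul_eq_mul, ZMod.natCast_zmod_val] at h
    have hr := congrArg (fun z ↦ Real.log ‖z‖) h
    simp only [norm_prod, norm_zpow, norm_one, Real.log_one] at hr
    rw [Real.log_prod] at hr
    · simp only [Real.log_zpow] at hr
      exact_mod_cast hr
    · intro i _
      exact zpow_ne_zero _ (norm_ne_zero_iff.2 (sub_ne_zero.2
        (stdAddChar_ne_one (by simpa using hj))))
  intro i
  refine Int.cast_eq_zero.1 (eq_zero_of_forall_sum_mul_char_eq_zero
    (c := fun i ↦ (a i : ℂ)) (fun χ ↦ ?_) i)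
  rcases χ.even_or_odd with heven | hodd
  · rcases eq_or_ne χ 1 with rfl | hχ
    · simpa using congrArg (Int.cast (R := ℂ)) h1
    · exact sum_mul_even_char_eq_zero hlog hχ heven
  · exact sum_mul_odd_char_eq_zero (fun i ↦ by rw [← h2]) hodd
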